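/- arXiv:math/0411132 — 2 statements merged into one kernel-verified Lean document; each statement's English description precedes it below -/
import Mathlib

section
/- Let C be a smooth projective curve of genus g ≥ 2 over the field of algebraic numbers Q̄, embedded in its Jacobian A via a rational point. Then it is NOT true that A(Q̄) = ∪_{r∈ℚ} r·C(Q̄): there exists a point of A(Q̄) that is not of the form r·c with r ∈ ℚ and c ∈ C(Q̄). Indeed, by the theorems of Faltings and Raynaud, the intersection of C(Q̄) with every finitely generated ℚ-subspace of A(Q̄) ⊗ ℚ is finite. -/
/-!
**Statement 7.**
Let `C` be a smooth projective curve of genus `g ≥ 2` over the field `Q̄` of algebraic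
numbers, embedded in its Jacobian `A` via a rational point.  Then it is NOT true that
`A(Q̄) = ⋃_{r ∈ ℚ} r·C(Q̄)`: there exists a point of `A(Q̄)` not of the form `r·c` with
`r ∈ ℚ`, `c ∈ C(Q̄)`.  (Indeed, by the theorems of Faltings and Raynaud, the intersection of
`C(Q̄)` with every finitely generated `ℚ`-subspace of `A(Q̄) ⊗ ℚ` is finite.)

Representation.  `A` stands for the abelian group `A(Q̄)` of `Q̄`-points of the Jacobian and
`C ⊆ A` for the (infinite, as `Q̄` is algebraically closed) set of `Q̄`-points of the curve,
which is embedded in its Jacobian via a base point and hence generates it.  For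
`r = r.num / r.den ∈ ℚ`, a point `x ∈ A(Q̄)` lies in `r·C(Q̄)` iff `r.den • x = r.num • c`
for some `c ∈ C(Q̄)`.  The Faltings–Raynaud input is recorded as the hypothesis that for
every finite subset `s ⊆ A`, only finitely many `c ∈ C` lie in the `ℚ`-subspace of
`A(Q̄) ⊗ ℚ` spanned by `s` (i.e. satisfy `n • c = ∑_{a ∈ s} f a • a` for some `n ≠ 0` and
integers `f a`).
-/
theorem statement7
    -- `Q̄`: the field of algebraic numbers
    (Qbar : Type*) [Field Qbar] [Algebra ℚ Qbar] [IsAlgClosure ℚ Qbar]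
    -- `A(Q̄)` and the `Q̄`-points of the curve `C` of genus `g ≥ 2` inside it
    (A : Type*) [AddCommGroup A]
    (C : Set A) (g : ℕ) (hg : 2 ≤ g)
    (hbase : (0 : A) ∈ C) (hCinf : C.Infinite)
    -- `C` is embedded in its Jacobian `A`, which it generates
    (hgen : AddSubgroup.closure C = ⊤)
    -- Faltings/Raynaud: `C(Q̄)` meets every finitely generated `ℚ`-subspace of `A(Q̄) ⊗ ℚ`
    -- in a finite set
    (hFaltingsRaynaud : ∀ s : Finset A,
      {c ∈ C | ∃ n : ℤ, n ≠ 0 ∧ ∃ f : A → ℤ, n • c = ∑ a ∈ s, f a • a}.Finite) :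
    -- it is NOT true that `A(Q̄) = ⋃_{r ∈ ℚ} r·C(Q̄)`
    ¬ (∀ x : A, ∃ r : ℚ, ∃ c ∈ C, (r.den : ℤ) • x = r.num • c) := by
  classical
  intro hcover
  obtain ⟨c₁, hc₁, hc₁'⟩ := hCinf.exists_notMem_finite (hFaltingsRaynaud ∅)
  obtain ⟨c₂, hc₂, hc₂'⟩ := hCinf.exists_notMem_finite (hFaltingsRaynaud {c₁})
  have htors : ∀ n : ℤ, n • c₁ = 0 → n = 0 := by
    intro n hn
    by_contra h
    exact hc₁' ⟨hc₁, n, h, 0, by simpa using hn⟩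
  have hindep : ∀ n m : ℤ, n • c₂ = m • c₁ → n = 0 := by
    intro n m hnm
    by_contra h
    exact hc₂' ⟨hc₂, n, h, fun _ => m, by simpa using hnm⟩
  have hne : c₁ ≠ c₂ := by
    rintro rfl
    exact one_ne_zero (hindep 1 1 rfl)
  choose r c hcC hrc using fun k : ℕ => hcover (c₁ + (k : ℤ) • c₂)
  have hden : ∀ k, ((r k).den : ℤ) ≠ 0 := fun k => by exact_mod_cast (r k).den_nz
  have hnum : ∀ k, (r k).num ≠ 0 := by
    intro k h
    have hk := hrc k
    rw [h, zero_smul] at hk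
    have h₂ : ((r k).den * k : ℤ) = 0 :=
      hindep _ (-(r k).den) (by linear_combination (norm := module) hk)
    have h₁ : ((r k).den : ℤ) • c₁ = 0 := by
      rw [smul_add, smul_smul, h₂, zero_smul, add_zero] at hk
      exact hk
    exact hden k (htors _ h₁)
  have hmem : ∀ k, c k ∈ {c ∈ C | ∃ n : ℤ, n ≠ 0 ∧ ∃ f : A → ℤ,
      n • c = ∑ a ∈ ({c₁, c₂} : Finset A), f a • a} := by
    intro k
    refine ⟨hcC k, (r k).num, hnum k,
      fun a => if a = c₁ then (r k).den else (r k).den * k, ?_⟩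
    rw [Finset.sum_pair hne]
    beta_reduce
    rw [if_pos rfl, if_neg hne.symm, ← hrc k, smul_add, smul_smul]
  obtain ⟨k, -, l, -, hkl, hc⟩ := Set.infinite_univ.exists_ne_map_eq_of_mapsTo
    (fun k _ => hmem k) (hFaltingsRaynaud {c₁, c₂})
  have hk := hrc k
  have hl := hrc l
  rw [← hc] at hl
  have key : ((r l).num * (r k).den) • (c₁ + (k : ℤ) • c₂) =
      ((r k).num * (r l).den) • (c₁ + (l : ℤ) • c₂) := by
    rw [mul_smul, hk, mul_smul, hl, smul_comm]
  have h₂ : (r l).num * (r k).den * k - (r k).num * (r l).den * l = 0 :=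
    hindep _ ((r k).num * (r l).den - (r l).num * (r k).den)
      (by linear_combination (norm := module) key)
  have h₁ : (r k).num * (r l).den - (r l).num * (r k).den = 0 := by
    apply htors
    have h := congrArg (fun n : ℤ => n • c₂) h₂
    simp only [zero_smul] at h
    linear_combination (norm := module) h - key
  have hmul : (r l).num * (r k).den * ((k : ℤ) - l) = 0 := by
    linear_combination h₂ + l * h₁
  rcases mul_eq_zero.mp hmul with h | h
  · exact mul_ne_zero (hnum l) (hden k) h
  · exact hkl (by exact_mod_cast sub_eq_zero.mp h)
end

section
/- Let p and ℓ be primes and n ≥ 1 an integer such that p does not divide the order of the finite group GL_n(ℤ/ℓℤ), i.e., ℓ ≠ p and ℓ^i ≢ 1 (mod p) for all i = 1, …, n. Then every continuous group homomorphism from the additive group of p-adic integers ℤ_p to GL_n(ℤ_ℓ) is trivial. -/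
theorem natCast_pow_succ_dvd_pow_sub_one {R : Type*} [Ring R] {M : R} {q k : ℕ}
    (hq : (q : R) ∣ M - 1) (hk : (q : R) ^ k ∣ M - 1) : (q : R) ^ (k + 1) ∣ M ^ q - 1 := by
  have hsum : (q : R) ∣ ∑ i ∈ Finset.range q, M ^ i := by
    have h : ∑ i ∈ Finset.range q, M ^ i = ∑ i ∈ Finset.range q, (M ^ i - 1) + (q : R) := by
      simp [Finset.sum_sub_distrib]
    rw [h]
    refine dvd_add (Finset.dvd_sum fun i _ => ?_) dvd_rfl
    rw [← mul_geom_sum]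
    exact hq.mul_right _
  obtain ⟨B, hB⟩ := hk
  obtain ⟨C, hC⟩ := hsum
  refine ⟨B * C, ?_⟩
  rw [← mul_geom_sum, hB, hC, pow_succ]
  simp only [mul_assoc]
  rw [← mul_assoc B, ← (Nat.cast_commute q B).eq, mul_assoc]

theorem PadicInt.eq_zero_of_forall_pow_dvd {q : ℕ} [Fact q.Prime] {a : ℤ_[q]}
    (h : ∀ k : ℕ, (q : ℤ_[q]) ^ k ∣ a) : a = 0 := by
  by_contra ha
  exact FiniteMultiplicity.of_prime_left PadicInt.prime_p ha |>.not_pow_dvd_of_multiplicity_lt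
    (Nat.lt_succ_self _) (h _)

theorem PadicInt.exists_eq_nsmul {p N : ℕ} [Fact p.Prime] (hN : ¬ p ∣ N) (x : ℤ_[p]) :
    ∃ y : ℤ_[p], x = N • y := by
  have hu : IsUnit (N : ℤ_[p]) := by
    rw [PadicInt.isUnit_iff, PadicInt.norm_natCast_eq_one_iff]
    exact (Nat.Prime.coprime_iff_not_dvd Fact.out).2 hN
  obtain ⟨y, hy⟩ := hu.dvd (a := x)
  exact ⟨y, by rw [nsmul_eq_mul, hy]⟩

theorem not_dvd_card_GL_zmod {p q n : ℕ} [Fact p.Prime] [Fact q.Prime] (hqp : q ≠ p)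
    (hord : ∀ i : ℕ, 1 ≤ i → i ≤ n → ¬ (q ^ i ≡ 1 [MOD p])) :
    ¬ p ∣ Nat.card (Matrix.GeneralLinearGroup (Fin n) (ZMod q)) := by
  have hp : p.Prime := Fact.out
  have hq : q.Prime := Fact.out
  rw [Matrix.card_GL_field, hp.prime.dvd_finsetProd_iff]
  rintro ⟨i, -, hi⟩
  rw [ZMod.card] at hi
  have hfac : q ^ n - q ^ (i : ℕ) = q ^ (i : ℕ) * (q ^ (n - i) - 1) := by
    rw [Nat.mul_sub, ← pow_add, mul_one, Nat.add_sub_cancel' i.2.le]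
  rw [hfac, hp.dvd_mul] at hi
  rcases hi with hi | hi
  · exact hqp ((Nat.prime_dvd_prime_iff_eq hp hq).1 (hp.dvd_of_dvd_pow hi)).symm
  · exact hord (n - i) (by lia) (by lia)
      ((Nat.modEq_iff_dvd' (Nat.one_le_pow _ _ hq.pos)).2 hi).symm

theorem Matrix.natCast_dvd_iff {n R : Type*} [Fintype n] [DecidableEq n] [CommRing R]
    {m : ℕ} {A : Matrix n n R} : (m : Matrix n n R) ∣ A ↔ ∀ i j, (m : R) ∣ A i j := by
  constructor
  · rintro ⟨B, rfl⟩ i j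
    exact ⟨B i j, by rw [← nsmul_eq_mul, Matrix.smul_apply, nsmul_eq_mul]⟩
  · intro h
    choose B hB using h
    refine ⟨Matrix.of B, ?_⟩
    ext i j
    rw [← nsmul_eq_mul, Matrix.smul_apply, nsmul_eq_mul, hB, Matrix.of_apply]

/-!
**Statement 8.**
Let `p` and `ℓ` be primes and `n ≥ 1` an integer such that `p` does not divide the order of
the finite group `GLₙ(ℤ/ℓℤ)`, i.e. (since
`|GLₙ(ℤ/ℓℤ)| = ℓ^{n(n-1)/2} · ∏_{i=1}^{n} (ℓ^i - 1)`) such that `ℓ ≠ p` and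
`ℓ^i ≢ 1 (mod p)` for all `i = 1, …, n`.  Then every continuous group homomorphism from the
additive group `ℤ_p` of `p`-adic integers to `GLₙ(ℤ_ℓ)` (with its `ℓ`-adic topology) is
trivial.
-/
theorem statement8
    (p ℓ : ℕ) [Fact p.Prime] [Fact ℓ.Prime] (n : ℕ) (hn : 1 ≤ n)
    -- `p ∤ |GLₙ(ℤ/ℓℤ)|`, i.e. `ℓ ≠ p` and `ℓ^i ≢ 1 (mod p)` for `i = 1, …, n`
    (hℓp : ℓ ≠ p)
    (hord : ∀ i : ℕ, 1 ≤ i → i ≤ n → ¬ (ℓ ^ i ≡ 1 [MOD p]))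
    -- a continuous homomorphism from the additive group `ℤ_p` to `GLₙ(ℤ_ℓ)`
    (f : ℤ_[p] → Matrix.GeneralLinearGroup (Fin n) ℤ_[ℓ])
    (hhom : ∀ x y : ℤ_[p], f (x + y) = f x * f y)
    (hcont : Continuous f) :
    -- `f` is trivial
    ∀ x : ℤ_[p], f x = 1 := by
  let F : Multiplicative ℤ_[p] →* Matrix.GeneralLinearGroup (Fin n) ℤ_[ℓ] :=
    MonoidHom.mk' (fun x => f x.toAdd) fun x y => hhom _ _
  have hpow (N : ℕ) (y : ℤ_[p]) : f (N • y) = f y ^ N := map_pow F (Multiplicative.ofAdd y) N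
  have hmod (x : ℤ_[p]) :
      ((ℓ : ℕ) : Matrix (Fin n) (Fin n) ℤ_[ℓ]) ∣ (f x : Matrix (Fin n) (Fin n) ℤ_[ℓ]) - 1 := by
    obtain ⟨y, rfl⟩ := PadicInt.exists_eq_nsmul (not_dvd_card_GL_zmod hℓp hord) x
    have h1 : Matrix.GeneralLinearGroup.map PadicInt.toZMod
        (f (Nat.card (Matrix.GeneralLinearGroup (Fin n) (ZMod ℓ)) • y)) = 1 := by
      rw [hpow, map_pow, pow_card_eq_one']
    rw [Matrix.natCast_dvd_iff]
    intro i j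
    rw [← Ideal.mem_span_singleton, ← PadicInt.maximalIdeal_eq_span_p, ← PadicInt.ker_toZMod,
      RingHom.mem_ker, Matrix.sub_apply, map_sub, sub_eq_zero]
    have h2 := congrArg (fun g : Matrix.GeneralLinearGroup (Fin n) (ZMod ℓ) => g i j) h1
    simpa [Matrix.one_apply, apply_ite] using h2
  have hall (k : ℕ) : ∀ x : ℤ_[p],
      (ℓ : Matrix (Fin n) (Fin n) ℤ_[ℓ]) ^ k ∣ (f x : Matrix (Fin n) (Fin n) ℤ_[ℓ]) - 1 := by
    induction k with
    | zero => simp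
    | succ k ih =>
      intro x
      obtain ⟨y, rfl⟩ := PadicInt.exists_eq_nsmul (p := p) (N := ℓ)
        (fun h => hℓp ((Nat.prime_dvd_prime_iff_eq Fact.out Fact.out).1 h).symm) x
      rw [hpow, Units.val_pow_eq_pow_val]
      exact natCast_pow_succ_dvd_pow_sub_one (hmod y) (ih y)
  intro x
  ext i j
  rw [← sub_eq_zero]
  refine PadicInt.eq_zero_of_forall_pow_dvd fun k => ?_
  have h := hall k x
  rw [← Nat.cast_pow, Matrix.natCast_dvd_iff] at h
  simpa using h i j
end
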